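/- Let k be a field and let φ : R_q^+ → k be a ring homomorphism with φ(q) = 0 (here q ∈ R_q^+ denotes the constant polynomial q). Then there exists N ∈ ℕ ∪ {∞} such that for every m ∈ ℕ, φ(B_q(m)) = 1 if m ≤ N and φ(B_q(m)) = 0 otherwise. Equivalently: φ(B_q(m)) ∈ {0, 1} for every m, and whenever m ≤ m' and φ(B_q(m')) = 1, also φ(B_q(m)) = 1. -/

import Mathlib

open Polynomial

noncomputable section

/-- `K = ℚ(q)`, the field of rational functions in `q` over `ℚ`. -/
abbrev K : Type := RatFunc ℚ

/-- The variable `q ∈ K`. -/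
def qq : K := RatFunc.X

/-- The quantum integer `[n]_q = (q^n - 1)/(q - 1) ∈ K`. -/
def qInt (n : ℤ) : K := (qq ^ n - 1) / (qq - 1)

/-- The quantum factorial `[n]_q! = ∏_{i=1}^n [i]_q`. -/
def qFact (n : ℕ) : K := ∏ i ∈ Finset.range n, qInt ((i : ℤ) + 1)

/-- The `q`-binomial coefficient polynomial `B_q(k) ∈ K[x]`, with `B_q(0) = 1`. -/
def Bq (k : ℕ) : K[X] :=
  C ((qq ^ (k.choose 2) * qFact k)⁻¹) * ∏ i ∈ Finset.range k, (X - C (qInt i))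

/-- The subring `ℤ[q]` of `K`. -/
def Zq : Subring K := Subring.closure {qq}

/-- The ring `R_q^+` of quantum integer-valued polynomials, as a subring of `K[x]`. -/
def RqPlus : Subring K[X] where
  carrier := {P | ∀ n : ℕ, P.eval (qInt (n : ℤ)) ∈ Zq}
  mul_mem' := by
    intro a b ha hb n
    rw [eval_mul]
    exact Zq.mul_mem (ha n) (hb n)
  one_mem' := by
    intro n
    rw [eval_one]
    exact Zq.one_mem
  add_mem' := by
    intro a b ha hb n
    rw [eval_add]
    exact Zq.add_mem (ha n) (hb n)
  zero_mem' := by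
    intro n
    rw [eval_zero]
    exact Zq.zero_mem
  neg_mem' := by
    intro a ha n
    rw [eval_neg]
    exact Zq.neg_mem (ha n)

lemma aux_pow (n : ℕ) : qq ^ (n + 1) ≠ 1 := by
  intro h
  have h1 : (algebraMap ℚ[X] K) ((X : ℚ[X]) ^ (n + 1)) = algebraMap ℚ[X] K 1 := by
    rw [map_pow, RatFunc.algebraMap_X, map_one]; exact h
  have h2 := RatFunc.algebraMap_injective ℚ h1
  have h3 := congrArg natDegree h2
  simp at h3

lemma aux_q0 : qq ≠ 0 := RatFunc.X_ne_zero

lemma aux_q1 : qq - 1 ≠ 0 := by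
  have := aux_pow 0
  rw [zero_add, pow_one] at this
  exact sub_ne_zero.mpr this

lemma aux_int (n : ℕ) : qInt ((n : ℤ) + 1) ≠ 0 := by
  have h : ((n : ℤ) + 1) = ((n + 1 : ℕ) : ℤ) := by push_cast; rfl
  rw [h, qInt, zpow_natCast]
  exact div_ne_zero (sub_ne_zero.mpr (aux_pow n)) aux_q1

lemma aux_int_succ (n : ℕ) : qInt ((n + 1 : ℕ) : ℤ) = 1 + qq * qInt (n : ℤ) := by
  rw [qInt, qInt, zpow_natCast, zpow_natCast]
  have := aux_q1
  field_simp
  ring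

lemma aux_fact (n : ℕ) : qFact n ≠ 0 := by
  rw [qFact, Finset.prod_ne_zero_iff]
  intro i _
  exact aux_int i

lemma aux_prod (n m : ℕ) : (∏ i ∈ Finset.range (m + 1), (qInt ((n + 1 : ℕ) : ℤ) - qInt i))
    = qInt ((n + 1 : ℕ) : ℤ) * qq ^ m * ∏ i ∈ Finset.range m, (qInt (n : ℤ) - qInt i) := by
  rw [Finset.prod_range_succ']
  have h0 : qInt ((0 : ℕ) : ℤ) = 0 := by simp [qInt]
  have h : ∀ i ∈ Finset.range m, (qInt ((n + 1 : ℕ) : ℤ) - qInt ((i + 1 : ℕ) : ℤ))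
      = qq * (qInt (n : ℤ) - qInt i) := by
    intro i _
    rw [aux_int_succ, aux_int_succ]; ring
  rw [Finset.prod_congr rfl h, Finset.prod_mul_distrib, Finset.prod_const, Finset.card_range, h0]
  ring

lemma aux_eval (n m : ℕ) : (Bq m).eval (qInt (n : ℤ)) =
    (qq ^ (m.choose 2) * qFact m)⁻¹ * ∏ i ∈ Finset.range m, (qInt (n : ℤ) - qInt i) := by
  simp [Bq, eval_prod]

lemma aux_pascal (n m : ℕ) : (Bq (m + 1)).eval (qInt ((n + 1 : ℕ) : ℤ)) =
    (Bq m).eval (qInt (n : ℤ)) + qq ^ (m + 1) * (Bq (m + 1)).eval (qInt (n : ℤ)) := by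
  rw [aux_eval, aux_eval, aux_eval, aux_prod, Finset.prod_range_succ]
  have hc : (m + 1).choose 2 = m + m.choose 2 := by
    rw [Nat.choose_succ_succ' m 1, Nat.choose_one_right]
  have hf : qFact (m + 1) = qFact m * qInt ((m + 1 : ℕ) : ℤ) := by
    rw [qFact, Finset.prod_range_succ, ← qFact]; push_cast; rfl
  have h1 := aux_fact m
  have h2 : qInt ((m + 1 : ℕ) : ℤ) ≠ 0 := by
    have := aux_int m
    exact_mod_cast this
  have h3 := aux_q0
  have h4 := aux_int_succ m
  rw [hc, hf, pow_add, aux_int_succ n]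
  generalize (∏ i ∈ Finset.range m, (qInt (n : ℤ) - qInt i)) = P
  generalize qInt ((m + 1 : ℕ) : ℤ) = a at *
  generalize qInt (m : ℤ) = b at *
  generalize qInt (n : ℤ) = c at *
  generalize qFact m = f at *
  generalize qq = q at *
  field_simp
  rw [h4]
  ring

lemma aux_q_mem : qq ∈ Zq := Subring.subset_closure rfl

lemma aux_mod (n : ℕ) : ∀ m : ℕ, ∃ z ∈ Zq,
    (Bq m).eval (qInt (n : ℤ)) = (if m ≤ n then 1 else 0) + qq * z := by
  induction n with
  | zero =>
    intro m
    refine ⟨0, Zq.zero_mem, ?_⟩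
    cases m with
    | zero => simp [Bq, qFact]
    | succ m => rw [aux_eval, Finset.prod_range_succ']; simp
  | succ n ih =>
    intro m
    cases m with
    | zero => exact ⟨0, Zq.zero_mem, by simp [Bq, qFact]⟩
    | succ m =>
      obtain ⟨z, hz, hz'⟩ := ih m
      obtain ⟨w, hw, hw'⟩ := ih (m + 1)
      have hm : (Bq (m + 1)).eval (qInt (n : ℤ)) ∈ Zq := by
        rw [hw']
        refine Zq.add_mem ?_ (Zq.mul_mem aux_q_mem hw)
        split_ifs
        exacts [Zq.one_mem, Zq.zero_mem]
      refine ⟨z + qq ^ m * (Bq (m + 1)).eval (qInt (n : ℤ)),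
        Zq.add_mem hz (Zq.mul_mem (Zq.pow_mem aux_q_mem m) hm), ?_⟩
      rw [aux_pascal, hz']
      simp only [Nat.add_le_add_iff_right]
      ring

lemma aux_mem (m l : ℕ) (h : m ≤ l) : C qq⁻¹ * (Bq m * Bq l - Bq l) ∈ RqPlus := by
  intro n
  obtain ⟨z, hz, hz'⟩ := aux_mod n m
  obtain ⟨w, hw, hw'⟩ := aux_mod n l
  rw [eval_mul, eval_sub, eval_mul, eval_C, hz', hw']
  have h0 := aux_q0
  by_cases hl : l ≤ n
  · have hm : m ≤ n := h.trans hl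
    rw [if_pos hl, if_pos hm]
    have : qq⁻¹ * ((1 + qq * z) * (1 + qq * w) - (1 + qq * w)) = z + qq * (z * w) := by
      field_simp
      ring
    rw [this]
    exact Zq.add_mem hz (Zq.mul_mem aux_q_mem (Zq.mul_mem hz hw))
  · rw [if_neg hl]
    have : ∀ e : K, qq⁻¹ * ((e + qq * z) * (0 + qq * w) - (0 + qq * w))
        = (e + qq * z) * w - w := by
      intro e
      field_simp
      ring
    rw [this]
    refine Zq.sub_mem (Zq.mul_mem (Zq.add_mem ?_ (Zq.mul_mem aux_q_mem hz)) hw) hw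
    split_ifs
    exacts [Zq.one_mem, Zq.zero_mem]

/-- If `φ : R_q^+ → k` is a ring homomorphism into a field sending the constant
polynomial `q` to `0`, then there is `N ∈ ℕ ∪ {∞}` with `φ(B_q(m)) = 1` for `m ≤ N` and
`φ(B_q(m)) = 0` otherwise. -/
theorem map_to_field_q_eq_zero (k : Type) [Field k] (φ : ↥RqPlus →+* k)
    (cq : ↥RqPlus) (hcq : (cq : K[X]) = C qq) (hφq : φ cq = 0)
    (Belt : ℕ → ↥RqPlus) (hB : ∀ m : ℕ, (Belt m : K[X]) = Bq m) :
    ∃ N : ℕ∞, ∀ m : ℕ, φ (Belt m) = if (m : ℕ∞) ≤ N then 1 else 0 := by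
  have key : ∀ m l : ℕ, m ≤ l → φ (Belt m) * φ (Belt l) = φ (Belt l) := by
    intro m l h
    have he : Belt m * Belt l - Belt l = cq * ⟨_, aux_mem m l h⟩ := by
      apply Subtype.ext
      push_cast
      rw [hB, hB, hcq, ← mul_assoc, ← C_mul, mul_inv_cancel₀ aux_q0, C_1, one_mul]
    have h2 := congrArg φ he
    rw [map_mul, hφq, zero_mul, map_sub, map_mul] at h2
    exact sub_eq_zero.mp h2
  have h01 : ∀ m, φ (Belt m) ≠ 0 → φ (Belt m) = 1 := fun m hm =>
    mul_right_cancel₀ hm ((key m m le_rfl).trans (one_mul _).symm)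
  have hdown : ∀ m l, m ≤ l → φ (Belt m) = 0 → φ (Belt l) = 0 := by
    intro m l h h0
    rw [← key m l h, h0, zero_mul]
  have hb0 : φ (Belt 0) = 1 := by
    have : Belt 0 = 1 := by
      apply Subtype.ext
      rw [hB]
      simp [Bq, qFact]
    rw [this, map_one]
  classical
  by_cases hex : ∃ m, φ (Belt m) = 0
  · have hs := Nat.find_spec hex
    have hmin : ∀ m, m < Nat.find hex → φ (Belt m) ≠ 0 := fun m hm => Nat.find_min hex hm
    generalize Nat.find hex = M at hs hmin
    cases M with
    | zero => rw [hb0] at hs; exact absurd hs one_ne_zero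
    | succ M =>
      refine ⟨(M : ℕ∞), fun m => ?_⟩
      simp only [Nat.cast_le]
      split_ifs with h
      · exact h01 m (hmin m (by omega))
      · exact hdown (M + 1) m (by omega) hs
  · refine ⟨⊤, fun m => ?_⟩
    rw [if_pos le_top]
    exact h01 m fun h => hex ⟨m, h⟩
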